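/- Let p ∈ ℂ[t] be a nonconstant polynomial. Then S_p has the concatenability property if and only if deg p = 1. -/

import Mathlib

open MeasureTheory Filter Topology

/-- `u` satisfies `p(d/dt) u = 0` in the sense of distributions: for every test function `φ`
(infinitely differentiable with compact support),
`∑ₖ aₖ (−1)ᵏ ∫ u(t) φ⁽ᵏ⁾(t) dt = 0`, where `p = ∑ₖ aₖ tᵏ`. -/
def IsDistSol (p : Polynomial ℂ) (u : ℝ → ℂ) : Prop :=
  ∀ φ : ℝ → ℂ, ContDiff ℝ (⊤ : ℕ∞) φ → HasCompactSupport φ →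
    ∑ k ∈ Finset.range (p.natDegree + 1),
      p.coeff k * ((-1 : ℂ) ^ k * ∫ t : ℝ, u t * iteratedDeriv k φ t) = 0

/-- Membership in `S_p`: `u` is continuous and solves `p(d/dt) u = 0` distributionally. -/
def MemSp (p : Polynomial ℂ) (u : ℝ → ℂ) : Prop :=
  Continuous u ∧ IsDistSol p u

/-- The concatenation `u₁ ⌢ u₂`: equal to `u₁(t)` for `t ≤ 0` and to `u₂(t)` for `t ≥ 0`
(when `u₁ 0 = u₂ 0` this matches both requirements). -/
noncomputable def concat (u₁ u₂ : ℝ → ℂ) : ℝ → ℂ := fun t => if t ≤ 0 then u₁ t else u₂ t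

/-- `S_p` has the concatenability property. -/
def Concatenable (p : Polynomial ℂ) : Prop :=
  ∀ u₁ u₂ : ℝ → ℂ, MemSp p u₁ → MemSp p u₂ →
    ContDiff ℝ 1 u₁ → ContDiff ℝ 1 u₂ → u₁ 0 = u₂ 0 →
    MemSp p (concat u₁ u₂)

/-- The space of test functions. -/
def TestFn : Submodule ℂ (ℝ → ℂ) where
  carrier := {φ | ContDiff ℝ (⊤ : ℕ∞) φ ∧ HasCompactSupport φ}
  add_mem' := fun ha hb => ⟨ha.1.add hb.1, ha.2.add hb.2⟩
  zero_mem' := ⟨contDiff_const, HasCompactSupport.zero⟩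
  smul_mem' := fun c f hf => ⟨contDiff_const.smul hf.1, by
    have := hf.2.smul_left (f := fun _ : ℝ => c)
    exact this⟩

/-- The operator `-d/dt` on test functions. -/
noncomputable def negD : Module.End ℂ TestFn where
  toFun φ := ⟨fun t => - deriv φ.1 t, by
    refine ⟨?_, ?_⟩
    · have := φ.2.1
      rw [contDiff_infty_iff_deriv] at this
      exact this.2.neg
    · exact (φ.2.2.deriv).neg⟩
  map_add' := by
    intro φ ψ
    ext t
    have h1 : DifferentiableAt ℝ φ.1 t := (φ.2.1.differentiable (by simp)) t
    have h2 : DifferentiableAt ℝ ψ.1 t := (ψ.2.1.differentiable (by simp)) t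
    have := deriv_add h1 h2
    simp only [Submodule.coe_add, Pi.add_apply]
    rw [this]; ring
  map_smul' := by
    intro c φ
    ext t
    have h1 : DifferentiableAt ℝ φ.1 t := (φ.2.1.differentiable (by simp)) t
    have := deriv_const_smul c h1
    simp only [Submodule.coe_smul, Pi.smul_apply, RingHom.id_apply]
    rw [this]; simp

theorem negD_apply (φ : TestFn) (t : ℝ) : (negD φ).1 t = - deriv φ.1 t := rfl

theorem negD_pow (k : ℕ) (φ : TestFn) (t : ℝ) :
    ((negD ^ k) φ).1 t = (-1 : ℂ) ^ k * iteratedDeriv k φ.1 t := by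
  induction k generalizing t with
  | zero => simp
  | succ k ih =>
    rw [pow_succ', Module.End.mul_apply, negD_apply, iteratedDeriv_succ]
    have : ((negD ^ k) φ).1 = fun t => (-1 : ℂ) ^ k * iteratedDeriv k φ.1 t := funext ih
    rw [this]
    simp only [deriv_const_mul_field]
    ring

theorem mul_integrable {w : ℝ → ℂ} (hw : LocallyIntegrable w) (φ : TestFn) :
    Integrable (fun t => w t * φ.1 t) := by
  have := hw.integrable_smul_left_of_hasCompactSupport φ.2.1.continuous φ.2.2
  simpa [mul_comm] using this

theorem isDistSol_iff (p : Polynomial ℂ) {u : ℝ → ℂ} (hu : LocallyIntegrable u) :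
    IsDistSol p u ↔ ∀ φ : TestFn, ∫ t, u t * (Polynomial.aeval negD p φ).1 t = 0 := by
  have key : ∀ φ : TestFn, ∑ k ∈ Finset.range (p.natDegree + 1),
      p.coeff k * ((-1 : ℂ) ^ k * ∫ t : ℝ, u t * iteratedDeriv k φ.1 t)
      = ∫ t, u t * (Polynomial.aeval negD p φ).1 t := by
    intro φ
    have h1 : ∀ t, u t * (Polynomial.aeval negD p φ).1 t = ∑ k ∈ Finset.range (p.natDegree + 1),
        p.coeff k * (u t * ((negD ^ k) φ).1 t) := by
      intro t
      rw [Polynomial.aeval_eq_sum_range]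
      simp only [LinearMap.sum_apply, LinearMap.smul_apply, Submodule.coe_sum, Finset.sum_apply,
        Submodule.coe_smul, Pi.smul_apply, smul_eq_mul, Finset.mul_sum]
      exact Finset.sum_congr rfl fun k _ => by ring
    simp_rw [h1]
    rw [integral_finsetSum _ fun k _ => (mul_integrable hu ((negD ^ k) φ)).const_mul _]
    refine Finset.sum_congr rfl fun k _ => ?_
    rw [integral_const_mul, ← integral_const_mul]
    congr 2
    ext t
    rw [negD_pow]; ring
  constructor
  · intro h φ
    rw [← key]; exact h φ.1 φ.2.1 φ.2.2
  · intro h φ h1 h2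
    exact (key ⟨φ, h1, h2⟩).trans (h _)

theorem aeval_X_sub (l : ℂ) (ψ : TestFn) (t : ℝ) :
    (Polynomial.aeval negD (Polynomial.X - Polynomial.C l) ψ).1 t
      = - deriv ψ.1 t - l * ψ.1 t := by
  simp [negD_apply, Module.algebraMap_end_apply]

section parts
variable {u v : ℝ → ℂ} {l : ℂ}

theorem parts_aux (hu : ∀ t, HasDerivAt u (l * u t + v t) t) (ψ : TestFn) (t : ℝ) :
    HasDerivAt (fun t => u t * ψ.1 t)
      (v t * ψ.1 t - u t * (Polynomial.aeval negD (Polynomial.X - Polynomial.C l) ψ).1 t) t := by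
  have h1 : HasDerivAt ψ.1 (deriv ψ.1 t) t :=
    ((ψ.2.1.differentiable (by simp)) t).hasDerivAt
  refine ((hu t).mul h1).congr_deriv ?_
  rw [aeval_X_sub]; ring

theorem parts_Ioi (hu : ∀ t, HasDerivAt u (l * u t + v t) t) (hv : Continuous v) (ψ : TestFn) :
    ∫ t in Set.Ioi 0, u t * (Polynomial.aeval negD (Polynomial.X - Polynomial.C l) ψ).1 t
      = u 0 * ψ.1 0 + ∫ t in Set.Ioi 0, v t * ψ.1 t := by
  have hc : Continuous u := continuous_iff_continuousAt.2 fun t => (hu t).continuousAt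
  have i1 := mul_integrable hv.locallyIntegrable ψ
  have i2 := mul_integrable hc.locallyIntegrable
    (Polynomial.aeval negD (Polynomial.X - Polynomial.C l) ψ)
  have cs : HasCompactSupport (fun t => u t * ψ.1 t) := ψ.2.2.mul_left
  have h := integral_Ioi_of_hasDerivAt_of_tendsto' (a := (0 : ℝ)) (m := 0)
    (fun t _ => parts_aux hu ψ t) (i1.sub i2).integrableOn
    (cs.is_zero_at_infty.mono_left atTop_le_cocompact)
  rw [integral_sub i1.integrableOn i2.integrableOn] at h
  linear_combination -h

theorem parts_Iic (hu : ∀ t, HasDerivAt u (l * u t + v t) t) (hv : Continuous v) (ψ : TestFn) :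
    ∫ t in Set.Iic 0, u t * (Polynomial.aeval negD (Polynomial.X - Polynomial.C l) ψ).1 t
      = - (u 0 * ψ.1 0) + ∫ t in Set.Iic 0, v t * ψ.1 t := by
  have hc : Continuous u := continuous_iff_continuousAt.2 fun t => (hu t).continuousAt
  have i1 := mul_integrable hv.locallyIntegrable ψ
  have i2 := mul_integrable hc.locallyIntegrable
    (Polynomial.aeval negD (Polynomial.X - Polynomial.C l) ψ)
  have cs : HasCompactSupport (fun t => u t * ψ.1 t) := ψ.2.2.mul_left
  have h := integral_Iic_of_hasDerivAt_of_tendsto' (a := (0 : ℝ)) (m := 0)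
    (fun t _ => parts_aux hu ψ t) (i1.sub i2).integrableOn
    (cs.is_zero_at_infty.mono_left atBot_le_cocompact)
  rw [integral_sub i1.integrableOn i2.integrableOn] at h
  linear_combination -h

theorem split_integral {f : ℝ → ℂ} (hf : Integrable f) :
    ∫ t, f t = (∫ t in Set.Iic 0, f t) + ∫ t in Set.Ioi 0, f t :=
  (intervalIntegral.integral_Iic_add_Ioi hf.integrableOn hf.integrableOn).symm

theorem parts_all (hu : ∀ t, HasDerivAt u (l * u t + v t) t) (hv : Continuous v) (ψ : TestFn) :
    ∫ t, u t * (Polynomial.aeval negD (Polynomial.X - Polynomial.C l) ψ).1 t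
      = ∫ t, v t * ψ.1 t := by
  have hc : Continuous u := continuous_iff_continuousAt.2 fun t => (hu t).continuousAt
  rw [split_integral (mul_integrable hv.locallyIntegrable ψ),
    split_integral (mul_integrable hc.locallyIntegrable _), parts_Ioi hu hv, parts_Iic hu hv]
  ring

end parts

theorem concat_continuous {u₁ u₂ : ℝ → ℂ} (h1 : Continuous u₁) (h2 : Continuous u₂)
    (h : u₁ 0 = u₂ 0) : Continuous (concat u₁ u₂) := by
  unfold concat
  refine Continuous.if_le h1 h2 continuous_id continuous_const ?_
  intro x hx
  have hx' : x = 0 := hx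
  rw [hx', h]

theorem concat_integral {u₁ u₂ : ℝ → ℂ} (h1 : Continuous u₁) (h2 : Continuous u₂)
    (h : u₁ 0 = u₂ 0) (ψ : TestFn) : ∫ t, concat u₁ u₂ t * ψ.1 t =
      (∫ t in Set.Iic 0, u₁ t * ψ.1 t) + ∫ t in Set.Ioi 0, u₂ t * ψ.1 t := by
  rw [split_integral (mul_integrable (concat_continuous h1 h2 h).locallyIntegrable ψ)]
  congr 1
  · refine setIntegral_congr_fun measurableSet_Iic fun t ht => ?_
    have ht' : t ≤ 0 := ht
    simp [concat, ht']
  · refine setIntegral_congr_fun measurableSet_Ioi fun t ht => ?_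
    have ht' : ¬ t ≤ 0 := not_le.2 ht
    simp [concat, ht']

theorem eq_zero_of_test {v : ℝ → ℂ} (hv : Continuous v)
    (h : ∀ ψ : TestFn, ∫ t, v t * ψ.1 t = 0) : v = 0 := by
  have h0 : ∀ᵐ t, v t = 0 := by
    refine ae_eq_zero_of_integral_contDiff_smul_eq_zero hv.locallyIntegrable fun g hg hgc => ?_
    have := h ⟨fun t => (g t : ℂ), Complex.ofRealCLM.contDiff.comp hg,
      hgc.comp_left (g := fun x : ℝ => (x : ℂ)) (by simp)⟩
    rw [← this]
    congr 1
    ext t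
    simp [mul_comm]
  exact (hv.ae_eq_iff_eq volume continuous_const).1 h0

theorem exists_test (r : Polynomial ℂ) (hr : r ≠ 0) :
    ∃ φ : TestFn, (Polynomial.aeval negD r φ).1 0 ≠ 0 := by
  obtain ⟨c, hc⟩ : ∃ c : ℂ, r.eval c ≠ 0 := by
    by_contra! hcon
    exact hr (Polynomial.funext (by simpa using hcon))
  let χ : ContDiffBump (0 : ℝ) := ⟨1, 2, by norm_num, by norm_num⟩
  let φ : TestFn := ⟨fun t => (χ t : ℂ) * Complex.exp (-c * t), by
    constructor
    · refine ContDiff.mul (Complex.ofRealCLM.contDiff.comp χ.contDiff) ?_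
      exact (contDiff_const.mul Complex.ofRealCLM.contDiff).cexp
    · refine HasCompactSupport.mul_right ?_
      exact χ.hasCompactSupport.comp_left (g := fun x : ℝ => (x : ℂ)) (by simp)⟩
  have h0 : φ.1 =ᶠ[𝓝 0] fun t => Complex.exp (-c * t) := by
    filter_upwards [χ.eventuallyEq_one] with t ht
    simp [φ, ht]
  have hk : ∀ k : ℕ, ((negD ^ k) φ).1 =ᶠ[𝓝 0] fun t => c ^ k * Complex.exp (-c * t) := by
    intro k
    induction k with
    | zero => simpa using h0
    | succ k ih =>
      filter_upwards [ih.deriv] with t ht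
      rw [pow_succ', Module.End.mul_apply, negD_apply, ht]
      have : HasDerivAt (fun t : ℝ => c ^ k * Complex.exp (-c * t))
          (c ^ k * (Complex.exp (-c * t) * (-c * 1))) t :=
        ((((hasDerivAt_id t).ofReal_comp).const_mul (-c)).cexp).const_mul _
      rw [this.deriv]; ring
  refine ⟨φ, ?_⟩
  have : (Polynomial.aeval negD r φ).1 0 = r.eval c := by
    rw [Polynomial.aeval_eq_sum_range, Polynomial.eval_eq_sum_range]
    simp only [LinearMap.sum_apply, LinearMap.smul_apply, Submodule.coe_sum, Finset.sum_apply,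
      Submodule.coe_smul, Pi.smul_apply, smul_eq_mul]
    refine Finset.sum_congr rfl fun k _ => ?_
    rw [(hk k).eq_of_nhds]; simp
  rwa [this]

theorem exists_factor (p : Polynomial ℂ) (hp : 0 < p.natDegree) :
    ∃ (l : ℂ) (q : Polynomial ℂ), p = (Polynomial.X - Polynomial.C l) * q ∧
      p.natDegree = q.natDegree + 1 ∧ q ≠ 0 := by
  obtain ⟨l, hl⟩ := IsAlgClosed.exists_root p
    (by intro h; rw [Polynomial.natDegree_eq_of_degree_eq_some h] at hp; exact lt_irrefl _ hp)
  obtain ⟨q, hq⟩ := Polynomial.dvd_iff_isRoot.2 hl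
  have hq0 : q ≠ 0 := by
    rintro rfl
    simp [hq] at hp
  refine ⟨l, q, hq, ?_, hq0⟩
  rw [hq, Polynomial.natDegree_mul (Polynomial.X_sub_C_ne_zero l) hq0,
    Polynomial.natDegree_X_sub_C, add_comm]

/-- Let `p ∈ ℂ[t]` be a nonconstant polynomial. Then `S_p` has the concatenability property
if and only if `deg p = 1`. -/
theorem concatenable_iff_degree_eq_one (p : Polynomial ℂ) (hp : 0 < p.natDegree) :
    Concatenable p ↔ p.natDegree = 1 := by
  obtain ⟨l, q, hpq, hdeg, hq0⟩ := exists_factor p hp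
  constructor
  · intro hC
    by_contra hne
    obtain ⟨m, r, hqr, -, hr0⟩ := exists_factor q (by omega)
    have hap : ∀ φ : TestFn, Polynomial.aeval negD p φ =
        Polynomial.aeval negD (Polynomial.X - Polynomial.C l)
          (Polynomial.aeval negD (Polynomial.X - Polynomial.C m)
            (Polynomial.aeval negD r φ)) := by
      intro φ
      rw [hpq, hqr, map_mul, map_mul]; rfl
    have hE : ∀ (a : ℂ) (t : ℝ), HasDerivAt (fun t : ℝ => Complex.exp (a * t))
        (a * Complex.exp (a * t)) t := by
      intro a t
      have := (((hasDerivAt_id t).ofReal_comp).const_mul a).cexp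
      refine this.congr_deriv ?_
      simp [mul_comm]
    have hEc : ∀ a : ℂ, Continuous (fun t : ℝ => Complex.exp (a * t)) := fun a => by fun_prop
    let v : ℝ → ℂ := fun t => Complex.exp (m * t)
    have hvc : Continuous v := hEc m
    have hv : ∀ t, HasDerivAt v (m * v t + (fun _ : ℝ => (0 : ℂ)) t) t := by
      intro t; simpa using hE m t
    let u : ℝ → ℂ := fun t => Complex.exp (l * t) * ∫ s in (0 : ℝ)..t, Complex.exp ((m - l) * s)
    have hu0 : u 0 = 0 := by simp [u]
    have hu : ∀ t, HasDerivAt u (l * u t + v t) t := by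
      intro t
      have h1 := (hE l t).mul
        ((hEc (m - l)).integral_hasStrictDerivAt 0 t).hasDerivAt
      refine h1.congr_deriv ?_
      rw [← Complex.exp_add]
      simp only [u, v]
      ring_nf
    have huc : Continuous u := continuous_iff_continuousAt.2 fun t => (hu t).continuousAt
    have huC1 : ContDiff ℝ 1 u := by
      rw [contDiff_one_iff_deriv]
      refine ⟨fun t => (hu t).differentiableAt, ?_⟩
      have : deriv u = fun t => l * u t + v t := funext fun t => (hu t).deriv
      rw [this]
      exact (continuous_const.mul huc).add hvc
    have hum : MemSp p u := by
      refine ⟨huc, (isDistSol_iff p huc.locallyIntegrable).2 fun φ => ?_⟩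
      rw [hap, parts_all hu hvc, parts_all hv continuous_const]
      simp
    have hzm : MemSp p (fun _ => 0) := by
      refine ⟨continuous_const, ?_⟩
      intro φ _ _
      simp
    have hc := hC _ u hzm hum contDiff_const huC1 hu0.symm
    obtain ⟨φ, hφ⟩ := exists_test r hr0
    have h := (isDistSol_iff p hc.1.locallyIntegrable).1 hc.2 φ
    rw [concat_integral continuous_const huc hu0.symm, hap, parts_Ioi hu hvc,
      parts_Ioi hv continuous_const, hu0] at h
    simp [v] at h
    exact hφ h
  · intro h1 u₁ u₂ hm1 hm2 hd1 hd2 h0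
    obtain ⟨a, ha⟩ : ∃ a, q = Polynomial.C a :=
      ⟨_, Polynomial.eq_C_of_natDegree_eq_zero (by omega)⟩
    have ha0 : a ≠ 0 := by rintro rfl; simp [ha] at hq0
    have hap : ∀ φ : TestFn, Polynomial.aeval negD p φ =
        Polynomial.aeval negD (Polynomial.X - Polynomial.C l) (a • φ) := by
      intro φ
      rw [hpq, ha, map_mul, Polynomial.aeval_C]; rfl
    have hsol : ∀ u, MemSp p u → ContDiff ℝ 1 u →
        ∀ t, HasDerivAt u (l * u t + (fun _ : ℝ => (0 : ℂ)) t) t := by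
      intro u hu hd
      have hd' := contDiff_one_iff_deriv.1 hd
      let v : ℝ → ℂ := fun t => deriv u t - l * u t
      have hvc : Continuous v := hd'.2.sub (continuous_const.mul hu.1)
      have hder : ∀ t, HasDerivAt u (l * u t + v t) t := by
        intro t
        refine (hd'.1 t).hasDerivAt.congr_deriv ?_
        simp [v]
      have hv0 : v = 0 := by
        refine eq_zero_of_test hvc fun ψ => ?_
        have h := (isDistSol_iff p hu.1.locallyIntegrable).1 hu.2 (a⁻¹ • ψ)
        rw [hap, smul_smul, mul_inv_cancel₀ ha0, one_smul, parts_all hder hvc] at h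
        exact h
      intro t
      have := hder t
      rw [hv0] at this
      exact this
    have hcc := concat_continuous hm1.1 hm2.1 h0
    refine ⟨hcc, (isDistSol_iff p hcc.locallyIntegrable).2 fun φ => ?_⟩
    rw [concat_integral hm1.1 hm2.1 h0, hap, parts_Ioi (hsol u₂ hm2 hd2) continuous_const,
      parts_Iic (hsol u₁ hm1 hd1) continuous_const, h0]
    simp
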